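/- arXiv:1909.09303 — 3 statements merged into one kernel-verified Lean document; each statement's English description precedes it below -/
import Mathlib

section
/- Let {X_i}_{i∈I} be a family of nonempty T₀ spaces. Then the product space ∏_{i∈I} X_i is a Rudin space if and only if X_i is a Rudin space for every i ∈ I. -/
universe u v

open Set TopologicalSpace

/-- The upper set `↑A` of a subset `A` in the specialization preorder of a topological
space, where `x ≤ y` iff `x ∈ closure {y}`. -/
def upSet (X : Type u) [TopologicalSpace X] (A : Set X) : Set X :=
  {y | ∃ a ∈ A, a ∈ closure ({y} : Set X)}

/-- The lower set `↓A` of a subset `A` in the specialization preorder. -/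
def downSet (X : Type u) [TopologicalSpace X] (A : Set X) : Set X :=
  {y | ∃ a ∈ A, y ∈ closure ({a} : Set X)}

/-- A subset `D` is directed in the specialization preorder (`x ≤ y` iff
`x ∈ closure {y}`): it is nonempty and each two members have an upper bound in `D`. -/
def SpecDirected {X : Type u} [TopologicalSpace X] (D : Set X) : Prop :=
  D.Nonempty ∧ ∀ a ∈ D, ∀ b ∈ D, ∃ c ∈ D,
    a ∈ closure ({c} : Set X) ∧ b ∈ closure ({c} : Set X)

/-- `x` is a supremum of `D` in the specialization preorder. -/
def IsSpecSup {X : Type u} [TopologicalSpace X] (D : Set X) (x : X) : Prop :=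
  (∀ d ∈ D, d ∈ closure ({x} : Set X)) ∧
    ∀ y : X, (∀ d ∈ D, d ∈ closure ({y} : Set X)) → x ∈ closure ({y} : Set X)

/-- A `d`-space: the specialization poset is a dcpo and every open set is Scott open,
i.e. inaccessible by suprema of directed sets. -/
def DSpace (X : Type u) [TopologicalSpace X] : Prop :=
  (∀ D : Set X, SpecDirected D → ∃ x : X, IsSpecSup D x) ∧
    ∀ U : Set X, IsOpen U → ∀ D : Set X, SpecDirected D → ∀ x : X,
      IsSpecSup D x → x ∈ U → (D ∩ U).Nonempty

/-- A nonempty compact saturated subset (saturated = upper set in the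
specialization preorder). -/
def IsCompactSaturated {X : Type u} [TopologicalSpace X] (K : Set X) : Prop :=
  K.Nonempty ∧ IsCompact K ∧ ∀ x ∈ K, ∀ y : X, x ∈ closure ({y} : Set X) → y ∈ K

/-- A filtered family of nonempty compact saturated sets: a nonempty family,
directed under reverse inclusion. -/
def FilteredFamily {X : Type u} [TopologicalSpace X] (𝒦 : Set (Set X)) : Prop :=
  𝒦.Nonempty ∧ (∀ K ∈ 𝒦, IsCompactSaturated K) ∧
    ∀ K₁ ∈ 𝒦, ∀ K₂ ∈ 𝒦, ∃ K₃ ∈ 𝒦, K₃ ⊆ K₁ ∧ K₃ ⊆ K₂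

/-- A well-filtered space. -/
def WellFiltered (X : Type u) [TopologicalSpace X] : Prop :=
  ∀ 𝒦 : Set (Set X), FilteredFamily 𝒦 →
    ∀ U : Set X, IsOpen U → ⋂₀ 𝒦 ⊆ U → ∃ K ∈ 𝒦, K ⊆ U

/-- A sober space: every irreducible closed subset is the closure of a unique point. -/
def SoberSpace (X : Type u) [TopologicalSpace X] : Prop :=
  ∀ A : Set X, IsIrreducible A → IsClosed A → ∃! x : X, closure ({x} : Set X) = A

/-- The underlying set of the Smyth power space: all nonempty compact saturated subsets. -/
abbrev KSp (X : Type u) [TopologicalSpace X] : Type u := {K : Set X // IsCompactSaturated K}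

/-- The Smyth power space `P_S(X)`: `K(X)` with the upper Vietoris topology, generated
by the sets `□U = {K : K ⊆ U}` for `U` open in `X`. -/
instance KSp.instTopologicalSpace (X : Type u) [TopologicalSpace X] :
    TopologicalSpace (KSp X) :=
  .generateFrom {S : Set (KSp X) | ∃ U : Set X, IsOpen U ∧ S = {K : KSp X | K.1 ⊆ U}}

/-- A Rudin set: a closed set which is minimal (under inclusion) among the closed sets
meeting every member of some filtered family of nonempty compact saturated sets. -/
def IsRudinSet {X : Type u} [TopologicalSpace X] (A : Set X) : Prop :=
  IsClosed A ∧ ∃ 𝒦 : Set (Set X), FilteredFamily 𝒦 ∧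
    (∀ K ∈ 𝒦, (A ∩ K).Nonempty) ∧
    ∀ B : Set X, IsClosed B → (∀ K ∈ 𝒦, (B ∩ K).Nonempty) → B ⊆ A → B = A

/-- A Rudin space: every irreducible closed subset is a Rudin set. -/
def RudinSpace (X : Type u) [TopologicalSpace X] : Prop :=
  ∀ A : Set X, IsIrreducible A → IsClosed A → IsRudinSet A

/-- A well-filtered determined (WD) set: for every continuous map into a well-filtered
space, the closure of the image is the closure of a unique point. -/
def IsWDSet {X : Type u} [TopologicalSpace X] (A : Set X) : Prop :=
  ∀ (Y : Type u) [TopologicalSpace Y], WellFiltered Y →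
    ∀ f : X → Y, Continuous f → ∃! y : Y, closure (f '' A) = closure ({y} : Set Y)

/-- A well-filtered determined (WD) space: every irreducible closed subset is a WD set. -/
def WDSpace (X : Type u) [TopologicalSpace X] : Prop :=
  ∀ A : Set X, IsIrreducible A → IsClosed A → IsWDSet A

/-- A DC space: every irreducible closed subset is the closure of a set which is
directed in the specialization preorder. -/
def DCSpace (X : Type u) [TopologicalSpace X] : Prop :=
  ∀ A : Set X, IsIrreducible A → IsClosed A → ∃ D : Set X, SpecDirected D ∧ A = closure D

/-- Local compactness: every open neighbourhood of a point contains a compact saturated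
neighbourhood of the point. -/
def LocallyCompactSat (X : Type u) [TopologicalSpace X] : Prop :=
  ∀ x : X, ∀ U : Set X, IsOpen U → x ∈ U →
    ∃ K : Set X, IsCompactSaturated K ∧ x ∈ interior K ∧ K ⊆ U

/-- Core compactness: for every point `x` and open `U ∋ x` there is an open `V ∋ x`
way below `U`: every open cover of `U` has a finite subfamily covering `V`. -/
def CoreCompact (X : Type u) [TopologicalSpace X] : Prop :=
  ∀ x : X, ∀ U : Set X, IsOpen U → x ∈ U →
    ∃ V : Set X, IsOpen V ∧ x ∈ V ∧
      ∀ 𝒞 : Set (Set X), (∀ W ∈ 𝒞, IsOpen W) → U ⊆ ⋃₀ 𝒞 →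
        ∃ 𝒟 : Set (Set X), 𝒟 ⊆ 𝒞 ∧ 𝒟.Finite ∧ V ⊆ ⋃₀ 𝒟

theorem isCompactSaturated_nhdsKer {X : Type u} [TopologicalSpace X] {S : Set X}
    (hne : S.Nonempty) (hS : IsCompact S) : IsCompactSaturated (nhdsKer S) := by
  refine ⟨hne.mono subset_nhdsKer, hS.nhdsKer, fun x hx y hxy => ?_⟩
  obtain ⟨a, ha, hxa⟩ := mem_nhdsKer_iff_specializes.1 hx
  exact mem_nhdsKer_iff_specializes.2 ⟨a, ha, (specializes_iff_mem_closure.2 hxy).trans hxa⟩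

/-- The closure of the continuous image of a Rudin set is a Rudin set. -/
theorem IsRudinSet.closure_image {X : Type u} {Y : Type v} [TopologicalSpace X]
    [TopologicalSpace Y] {A : Set X} (hA : IsRudinSet A) {f : X → Y} (hf : Continuous f) :
    IsRudinSet (closure (f '' A)) := by
  obtain ⟨hAc, 𝒦, ⟨hne, hK, hdir⟩, hmeet, hmin⟩ := hA
  refine ⟨isClosed_closure, (fun K => nhdsKer (f '' (A ∩ K))) '' 𝒦, ⟨hne.image _, ?_, ?_⟩, ?_, ?_⟩
  · rintro _ ⟨K, hKm, rfl⟩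
    exact isCompactSaturated_nhdsKer ((hmeet K hKm).image f)
      (((hK K hKm).2.1.inter_left hAc).image hf)
  · rintro _ ⟨K₁, h₁, rfl⟩ _ ⟨K₂, h₂, rfl⟩
    obtain ⟨K₃, h₃, h₃₁, h₃₂⟩ := hdir K₁ h₁ K₂ h₂
    exact ⟨_, mem_image_of_mem _ h₃,
      nhdsKer_mono (image_mono (inter_subset_inter_right A h₃₁)),
      nhdsKer_mono (image_mono (inter_subset_inter_right A h₃₂))⟩
  · rintro _ ⟨K, hKm, rfl⟩
    obtain ⟨a, haA, haK⟩ := hmeet K hKm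
    exact ⟨f a, subset_closure (mem_image_of_mem f haA),
      subset_nhdsKer (mem_image_of_mem f ⟨haA, haK⟩)⟩
  · intro B hB hBm hBA
    refine hBA.antisymm (closure_minimal ?_ hB)
    have h : A ∩ f ⁻¹' B = A := by
      refine hmin _ (hAc.inter (hB.preimage hf)) (fun K hKm => ?_) inter_subset_left
      obtain ⟨b, hbB, hbK⟩ := hBm _ (mem_image_of_mem _ hKm)
      obtain ⟨_, ⟨a, ⟨haA, haK⟩, rfl⟩, hba⟩ := mem_nhdsKer_iff_specializes.1 hbK
      exact ⟨a, ⟨haA, hba.mem_closed hB hbB⟩, haK⟩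
    exact image_subset_iff.2 (inter_eq_left.1 h)

/-- A retract of a Rudin space is a Rudin space. -/
theorem RudinSpace.of_leftInverse {X : Type u} {Y : Type v} [TopologicalSpace X]
    [TopologicalSpace Y] (hX : RudinSpace X) {f : X → Y} {g : Y → X} (hf : Continuous f)
    (hg : Continuous g) (hfg : Function.LeftInverse f g) : RudinSpace Y := by
  intro A hA hAc
  have h := (hX (closure (g '' A)) (hA.image g hg.continuousOn).closure
    isClosed_closure).closure_image hf
  rwa [closure_image_closure hf, image_image, funext hfg, image_id', hAc.closure_eq] at h

/-- Rudin's lemma: a closed set meeting every member of a filtered family of compact sets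
contains a minimal such closed set, and the latter is irreducible. -/
theorem FilteredFamily.exists_irreducible_subset {X : Type u} [TopologicalSpace X]
    {𝒦 : Set (Set X)} (h𝒦 : FilteredFamily 𝒦) {B : Set X} (hB : IsClosed B)
    (hBm : ∀ K ∈ 𝒦, (B ∩ K).Nonempty) :
    ∃ C ⊆ B, IsClosed C ∧ IsIrreducible C ∧ ∀ K ∈ 𝒦, (C ∩ K).Nonempty := by
  obtain ⟨hne, hK, hdir⟩ := h𝒦
  obtain ⟨C, hCB, hC⟩ := zorn_superset_nonempty
    {C : Set X | IsClosed C ∧ ∀ K ∈ 𝒦, (C ∩ K).Nonempty} (by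
      intro c hc hchain hcne
      refine ⟨⋂₀ c, ⟨isClosed_sInter fun s hs => (hc hs).1, fun K hKm => ?_⟩,
        fun s hs => sInter_subset_of_mem hs⟩
      have : Nonempty c := hcne.to_subtype
      by_contra hemp
      rw [not_nonempty_iff_eq_empty, inter_comm, sInter_eq_iInter] at hemp
      obtain ⟨s, hs⟩ := (hK K hKm).2.1.elim_directed_family_closed
        (fun s : c => (s : Set X)) (fun s => (hc s.2).1) hemp
        fun s t => (hchain.total s.2 t.2).elim (fun h => ⟨s, Subset.rfl, h⟩)
          fun h => ⟨t, h, Subset.rfl⟩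
      have := (hc s.2).2 K hKm
      rw [inter_comm, hs] at this
      exact not_nonempty_empty this) B ⟨hB, hBm⟩
  obtain ⟨⟨hCc, hCm⟩, hmin⟩ := hC
  refine ⟨C, hCB, hCc, ⟨?_, ?_⟩, hCm⟩
  · obtain ⟨K, hKm⟩ := hne
    exact (hCm K hKm).left
  · rw [isPreirreducible_iff_isClosed_union_isClosed]
    intro F₁ F₂ hF₁ hF₂ hsub
    by_contra! hcon
    have key : ∀ F : Set X, IsClosed F → ¬ C ⊆ F → ∃ K ∈ 𝒦, ¬ ((C ∩ F) ∩ K).Nonempty := by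
      intro F hF hCF
      by_contra! hall
      exact hCF fun x hx => (hmin ⟨hCc.inter hF, hall⟩ inter_subset_left hx).2
    obtain ⟨K₁, h₁, hK₁⟩ := key F₁ hF₁ hcon.1
    obtain ⟨K₂, h₂, hK₂⟩ := key F₂ hF₂ hcon.2
    obtain ⟨K₃, h₃, h₃₁, h₃₂⟩ := hdir K₁ h₁ K₂ h₂
    obtain ⟨x, hxC, hxK⟩ := hCm K₃ h₃
    rcases hsub hxC with hx | hx
    · exact hK₁ ⟨x, ⟨hxC, hx⟩, h₃₁ hxK⟩
    · exact hK₂ ⟨x, ⟨hxC, hx⟩, h₃₂ hxK⟩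

theorem IsIrreducible.inter_biInter_nonempty {X : Type u} [TopologicalSpace X] {A : Set X}
    (hA : IsIrreducible A) {κ : Type v} (s : Finset κ) (U : κ → Set X)
    (hU : ∀ k ∈ s, IsOpen (U k)) (hAU : ∀ k ∈ s, (A ∩ U k).Nonempty) :
    (A ∩ ⋂ k ∈ s, U k).Nonempty := by
  classical
  induction s using Finset.induction_on with
  | empty => simpa using hA.1
  | insert k s _ ih =>
    rw [Finset.set_biInter_insert]
    exact hA.2 _ _ (hU k (s.mem_insert_self k))
      (isOpen_biInter_finset fun j hj => hU j (Finset.mem_insert_of_mem hj))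
      (hAU k (s.mem_insert_self k))
      (ih (fun j hj => hU j (Finset.mem_insert_of_mem hj))
        fun j hj => hAU j (Finset.mem_insert_of_mem hj))

/-- An irreducible closed subset of a product is the product of the closures of its
projections. -/
theorem IsIrreducible.eq_pi_closure_image_eval {ι : Type u} {X : ι → Type v}
    [∀ i, TopologicalSpace (X i)] {A : Set (∀ i, X i)} (hA : IsIrreducible A)
    (hAc : IsClosed A) : A = univ.pi fun i => closure (Function.eval i '' A) := by
  refine Subset.antisymm
    (fun x hx i _ => subset_closure (mem_image_of_mem _ hx)) fun x hx => ?_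
  rw [← hAc.closure_eq, mem_closure_iff]
  intro O hO hxO
  obtain ⟨s, U, hU, hsub⟩ := isOpen_pi_iff.1 hO x hxO
  obtain ⟨y, hyA, hyU⟩ := hA.inter_biInter_nonempty s (fun i => Function.eval i ⁻¹' U i)
    (fun i hi => (hU i hi).1.preimage (continuous_apply i)) (fun i hi => by
      obtain ⟨_, hzU, z, hzA, rfl⟩ := mem_closure_iff.1 (hx i trivial) (U i) (hU i hi).1 (hU i hi).2
      exact ⟨z, hzA, hzU⟩)
  exact ⟨y, hsub fun i hi => mem_iInter₂.1 hyU i hi, hyA⟩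

theorem IsCompactSaturated.univ_pi {ι : Type u} {X : ι → Type v}
    [∀ i, TopologicalSpace (X i)] {K : ∀ i, Set (X i)} (hK : ∀ i, IsCompactSaturated (K i)) :
    IsCompactSaturated (univ.pi K) :=
  ⟨univ_pi_nonempty_iff.2 fun i => (hK i).1, isCompact_univ_pi fun i => (hK i).2.1,
    fun x hx y hxy i _ => (hK i).2.2 (x i) (hx i trivial) (y i) <|
      specializes_iff_mem_closure.1 <|
        (specializes_iff_mem_closure.2 hxy).map (continuous_apply i)⟩

theorem FilteredFamily.univ_pi {ι : Type u} {X : ι → Type v} [∀ i, TopologicalSpace (X i)]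
    {𝒦 : ∀ i, Set (Set (X i))} (h𝒦 : ∀ i, FilteredFamily (𝒦 i)) :
    FilteredFamily (univ.pi '' univ.pi 𝒦) := by
  refine ⟨(univ_pi_nonempty_iff.2 fun i => (h𝒦 i).1).image _, ?_, ?_⟩
  · rintro _ ⟨K, hK, rfl⟩
    exact .univ_pi fun i => (h𝒦 i).2.1 _ (hK i trivial)
  · rintro _ ⟨K, hK, rfl⟩ _ ⟨L, hL, rfl⟩
    choose M hM hMK hML using fun i => (h𝒦 i).2.2 _ (hK i trivial) _ (hL i trivial)
    exact ⟨_, mem_image_of_mem _ fun i _ => hM i, pi_mono fun i _ => hMK i,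
      pi_mono fun i _ => hML i⟩

theorem RudinSpace.pi {ι : Type u} {X : ι → Type v} [∀ i, TopologicalSpace (X i)]
    (hX : ∀ i, RudinSpace (X i)) : RudinSpace (∀ i, X i) := by
  classical
  intro A hA hAc
  choose _ 𝒦 h𝒦 hmeet hmin using fun i => hX i (closure (Function.eval i '' A))
    (hA.image _ (continuous_apply i).continuousOn).closure isClosed_closure
  have hAeq := hA.eq_pi_closure_image_eval hAc
  refine ⟨hAc, univ.pi '' univ.pi 𝒦, .univ_pi h𝒦, ?_, ?_⟩
  · rintro _ ⟨K, hK, rfl⟩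
    choose x hxA hxK using fun i => hmeet i (K i) (hK i trivial)
    exact ⟨x, hAeq ▸ fun i _ => hxA i, fun i _ => hxK i⟩
  · intro B hB hBm hBA
    refine hBA.antisymm ?_
    obtain ⟨C, hCB, hCc, hC, hCm⟩ := (FilteredFamily.univ_pi h𝒦).exists_irreducible_subset hB hBm
    refine Subset.trans (Eq.subset ?_) hCB
    rw [hAeq, hC.eq_pi_closure_image_eval hCc]
    congr 1
    funext i
    refine (hmin i _ isClosed_closure (fun K hK => ?_)
      (closure_mono (image_mono (hCB.trans hBA)))).symm
    choose L hL using fun j => (h𝒦 j).1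
    have hLK : Function.update L i K ∈ univ.pi 𝒦 := by
      intro j _
      rcases eq_or_ne j i with rfl | hj
      · simpa using hK
      · simpa [hj] using hL j
    obtain ⟨x, hxC, hxK⟩ := hCm _ (mem_image_of_mem univ.pi hLK)
    exact ⟨x i, subset_closure (mem_image_of_mem _ hxC), by simpa using hxK i trivial⟩

/-- A product of nonempty T₀ spaces is a Rudin space iff every factor is
a Rudin space. -/
theorem stmt7 {ι : Type u} (X : ι → Type v) [∀ i, TopologicalSpace (X i)]
    [∀ i, T0Space (X i)] [∀ i, Nonempty (X i)] :
    RudinSpace (∀ i, X i) ↔ ∀ i, RudinSpace (X i) := by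
  classical
  refine ⟨fun h i => ?_, .pi⟩
  have c : ∀ j, X j := fun j => Classical.arbitrary _
  exact h.of_leftInverse (continuous_apply i) (continuous_const.update i continuous_id)
    (fun x => Function.update_self i x c)
end

section
/- For a T₀ space X the following are equivalent: (1) X is well-filtered; (2) the Smyth power space P_S(X) is a d-space; (3) the Smyth power space P_S(X) is well-filtered. -/
universe u v

open Set TopologicalSpace

theorem isTopologicalBasis_box (X : Type u) [TopologicalSpace X] :
    IsTopologicalBasis
      {S : Set (KSp X) | ∃ U : Set X, IsOpen U ∧ S = {K : KSp X | K.1 ⊆ U}} where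
  exists_subset_inter := by
    rintro _ ⟨U, hU, rfl⟩ _ ⟨V, hV, rfl⟩ K ⟨hKU, hKV⟩
    exact ⟨_, ⟨U ∩ V, hU.inter hV, rfl⟩, subset_inter hKU hKV,
      fun L hL => ⟨fun x hx => (hL hx).1, fun x hx => (hL hx).2⟩⟩
  sUnion_eq := eq_univ_of_forall fun K =>
    ⟨_, ⟨univ, isOpen_univ, rfl⟩, subset_univ K.1⟩
  eq_generateFrom := rfl

section

variable {X : Type u} [TopologicalSpace X]

theorem isOpen_box {U : Set X} (hU : IsOpen U) : IsOpen {K : KSp X | K.1 ⊆ U} :=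
  (isTopologicalBasis_box X).isOpen ⟨U, hU, rfl⟩

theorem exists_box_subset {𝒰 : Set (KSp X)} (h𝒰 : IsOpen 𝒰) {K : KSp X} (hK : K ∈ 𝒰) :
    ∃ U : Set X, IsOpen U ∧ K.1 ⊆ U ∧ ∀ L : KSp X, L.1 ⊆ U → L ∈ 𝒰 := by
  obtain ⟨_, ⟨U, hU, rfl⟩, hKU, hsub⟩ :=
    (isTopologicalBasis_box X).exists_subset_of_mem_open hK h𝒰
  exact ⟨U, hU, hKU, fun L hL => hsub hL⟩

theorem mem_of_isOpen_of_subset {𝒰 : Set (KSp X)} (h𝒰 : IsOpen 𝒰) {K L : KSp X}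
    (hK : K ∈ 𝒰) (hLK : L.1 ⊆ K.1) : L ∈ 𝒰 := by
  obtain ⟨U, -, hKU, hsub⟩ := exists_box_subset h𝒰 hK
  exact hsub L (hLK.trans hKU)

/-- Compact saturated sets containing a given point form a closed set of the power space. -/
theorem isClosed_setOf_mem (x : X) : IsClosed {K : KSp X | x ∈ K.1} := by
  have h : {K : KSp X | x ∈ K.1} = {K : KSp X | K.1 ⊆ (closure {x})ᶜ}ᶜ := by
    ext K
    simp only [mem_ofPred_eq, mem_compl_iff]
    refine ⟨fun hx h => h hx (subset_closure rfl), fun h => ?_⟩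
    by_contra hx
    exact h fun k hk hkx => hx (K.2.2.2 k hk x hkx)
  rw [h]
  exact (isOpen_box isClosed_closure.isOpen_compl).isClosed_compl

theorem mem_closure_singleton_iff_subset {K L : KSp X} :
    K ∈ closure ({L} : Set (KSp X)) ↔ L.1 ⊆ K.1 := by
  refine ⟨fun h x hx => ?_, fun h => mem_closure_iff.2 fun 𝒰 h𝒰 hK =>
    ⟨L, mem_of_isOpen_of_subset h𝒰 hK h, rfl⟩⟩
  have hsub : ({L} : Set (KSp X)) ⊆ {M : KSp X | x ∈ M.1} := singleton_subset_iff.2 hx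
  exact closure_minimal hsub (isClosed_setOf_mem x) h

theorem isCompactSaturated_sInter (hX : WellFiltered X) {𝒦 : Set (Set X)}
    (h𝒦 : FilteredFamily 𝒦) : IsCompactSaturated (⋂₀ 𝒦) := by
  refine ⟨?_, ?_, fun x hx y hxy K hK => (h𝒦.2.1 K hK).2.2 x (hx K hK) y hxy⟩
  · by_contra h
    obtain ⟨K, hK, hK0⟩ := hX 𝒦 h𝒦 ∅ isOpen_empty (not_nonempty_iff_eq_empty.1 h).subset
    exact ((h𝒦.2.1 K hK).1.mono hK0).ne_empty rfl
  · refine isCompact_of_finite_subcover fun U hU hsub => ?_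
    obtain ⟨K, hK, hKU⟩ := hX 𝒦 h𝒦 _ (isOpen_iUnion hU) hsub
    obtain ⟨t, ht⟩ := (h𝒦.2.1 K hK).2.1.elim_finite_subcover U hU hKU
    exact ⟨t, (sInter_subset_of_mem hK).trans ht⟩

theorem filteredFamily_image_val {D : Set (KSp X)} (hD : SpecDirected D) :
    FilteredFamily (Subtype.val '' D) := by
  refine ⟨hD.1.image _, ?_, ?_⟩
  · rintro _ ⟨K, -, rfl⟩
    exact K.2
  · rintro _ ⟨K, hK, rfl⟩ _ ⟨L, hL, rfl⟩
    obtain ⟨M, hM, h₁, h₂⟩ := hD.2 K hK L hL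
    exact ⟨M, ⟨M, hM, rfl⟩, mem_closure_singleton_iff_subset.1 h₁,
      mem_closure_singleton_iff_subset.1 h₂⟩

theorem WellFiltered.dSpace_kSp (hX : WellFiltered X) : DSpace (KSp X) := by
  refine ⟨fun D hD => ?_, fun 𝒰 h𝒰 D hD K hK hK𝒰 => ?_⟩
  · refine ⟨⟨_, isCompactSaturated_sInter hX (filteredFamily_image_val hD)⟩,
      fun K hK => mem_closure_singleton_iff_subset.2 (sInter_subset_of_mem ⟨K, hK, rfl⟩),
      fun L hL => mem_closure_singleton_iff_subset.2 ?_⟩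
    rintro x hx _ ⟨K, hK, rfl⟩
    exact mem_closure_singleton_iff_subset.1 (hL K hK) hx
  · obtain ⟨U, hU, hKU, hsub⟩ := exists_box_subset h𝒰 hK𝒰
    have hle : ⋂₀ (Subtype.val '' D) ⊆ K.1 :=
      mem_closure_singleton_iff_subset.1 <|
        hK.2 ⟨_, isCompactSaturated_sInter hX (filteredFamily_image_val hD)⟩ fun L hL =>
          mem_closure_singleton_iff_subset.2 (sInter_subset_of_mem ⟨L, hL, rfl⟩)
    obtain ⟨_, ⟨L, hL, rfl⟩, hLU⟩ :=
      hX _ (filteredFamily_image_val hD) U hU (hle.trans hKU)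
    exact ⟨L, hL, hsub L hLU⟩

theorem wellFiltered_of_dSpace_kSp (h : DSpace (KSp X)) : WellFiltered X := by
  intro 𝒦 h𝒦 U hU hsub
  have hD : SpecDirected {K : KSp X | K.1 ∈ 𝒦} := by
    refine ⟨?_, fun K hK L hL => ?_⟩
    · obtain ⟨K, hK⟩ := h𝒦.1
      exact ⟨⟨K, h𝒦.2.1 K hK⟩, hK⟩
    · obtain ⟨M, hM, h₁, h₂⟩ := h𝒦.2.2 K.1 hK L.1 hL
      exact ⟨⟨M, h𝒦.2.1 M hM⟩, hM, mem_closure_singleton_iff_subset.2 h₁,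
        mem_closure_singleton_iff_subset.2 h₂⟩
  obtain ⟨S, hS⟩ := h.1 _ hD
  have hSU : S.1 ⊆ U := fun x hx => hsub fun K hK =>
    mem_closure_singleton_iff_subset.1 (hS.1 ⟨K, h𝒦.2.1 K hK⟩ hK) hx
  obtain ⟨K, hK, hKU⟩ := h.2 _ (isOpen_box hU) _ hD S hS hSU
  exact ⟨K.1, hK, hKU⟩

theorem wellFiltered_of_wellFiltered_kSp (h : WellFiltered (KSp X)) : WellFiltered X := by
  intro 𝒦 h𝒦 U hU hsub
  let up : Set X → Set (KSp X) := fun K => {L | L.1 ⊆ K}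
  have hup : FilteredFamily (up '' 𝒦) := by
    refine ⟨h𝒦.1.image _, ?_, ?_⟩
    · rintro _ ⟨K, hK, rfl⟩
      refine ⟨⟨⟨K, h𝒦.2.1 K hK⟩, Subset.rfl⟩, ?_, fun L hL M hM =>
        (mem_closure_singleton_iff_subset.1 hM).trans hL⟩
      refine isCompact_of_finite_subcover fun V hV hcov => ?_
      obtain ⟨i, hi⟩ := mem_iUnion.1
        (hcov (show (⟨K, h𝒦.2.1 K hK⟩ : KSp X) ∈ up K from Subset.rfl))
      exact ⟨{i}, fun L hL => mem_biUnion (Finset.mem_singleton_self i)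
        (mem_of_isOpen_of_subset (hV i) hi hL)⟩
    · rintro _ ⟨K, hK, rfl⟩ _ ⟨L, hL, rfl⟩
      obtain ⟨M, hM, h₁, h₂⟩ := h𝒦.2.2 K hK L hL
      exact ⟨_, ⟨M, hM, rfl⟩, fun N hN => Subset.trans hN h₁, fun N hN => Subset.trans hN h₂⟩
  obtain ⟨_, ⟨K, hK, rfl⟩, hKU⟩ := h _ hup _ (isOpen_box hU) fun L hL x hx =>
    hsub fun K hK => hL _ ⟨K, hK, rfl⟩ hx
  exact ⟨K, hK, hKU (show (⟨K, h𝒦.2.1 K hK⟩ : KSp X) ∈ up K from Subset.rfl)⟩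

/-- The topological Rudin lemma, without irreducibility of the minimal closed set. -/
theorem exists_minimal_isClosed_inter_nonempty {𝒦 : Set (Set X)}
    (h𝒦 : ∀ K ∈ 𝒦, IsCompact K) {C : Set X} (hC : IsClosed C)
    (hmeet : ∀ K ∈ 𝒦, (C ∩ K).Nonempty) :
    ∃ A ⊆ C, Minimal (fun A => IsClosed A ∧ ∀ K ∈ 𝒦, (A ∩ K).Nonempty) A := by
  refine zorn_superset_nonempty {A | IsClosed A ∧ ∀ K ∈ 𝒦, (A ∩ K).Nonempty} ?_ C ⟨hC, hmeet⟩
  intro c hc hchain hne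
  refine ⟨⋂₀ c, ⟨isClosed_sInter fun A hA => (hc hA).1, fun K hK => ?_⟩,
    fun A hA => sInter_subset_of_mem hA⟩
  by_contra hempty
  have : Nonempty c := hne.to_subtype
  obtain ⟨A, hA⟩ := (h𝒦 K hK).elim_directed_family_closed
    (fun A : c => A.1) (fun A => (hc A.2).1)
    (by rw [← sInter_eq_iInter, inter_comm]; exact not_nonempty_iff_eq_empty.1 hempty)
    (fun A B => (hchain.total A.2 B.2).elim (fun h => ⟨A, Subset.rfl, h⟩)
      fun h => ⟨B, h, Subset.rfl⟩)
  have := (hc A.2).2 K hK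
  rw [inter_comm, hA] at this
  exact this.ne_empty rfl

theorem isCompactSaturated_biUnion {𝒜 : Set (KSp X)} (hne : 𝒜.Nonempty) (hc : IsCompact 𝒜) :
    IsCompactSaturated (⋃ K ∈ 𝒜, K.1) := by
  refine ⟨?_, ?_, ?_⟩
  · obtain ⟨K, hK⟩ := hne
    exact K.2.1.mono (subset_biUnion_of_mem (u := fun K : KSp X => K.1) hK)
  · refine isCompact_of_finite_subcover fun {ι} U hU hsub => ?_
    classical
    obtain ⟨t, ht⟩ := hc.elim_directed_cover
      (fun t : Finset ι => {K : KSp X | K.1 ⊆ ⋃ i ∈ t, U i})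
      (fun t => isOpen_box (isOpen_biUnion fun i _ => hU i))
      (fun K hK => mem_iUnion.2 <| K.2.2.1.elim_finite_subcover U hU
        ((subset_biUnion_of_mem (u := fun K : KSp X => K.1) hK).trans hsub))
      (fun s t => ⟨s ∪ t,
        fun K hK => Subset.trans hK
          (biUnion_mono (fun _ => Finset.mem_union_left t) fun _ _ => Subset.rfl),
        fun K hK => Subset.trans hK
          (biUnion_mono (fun _ => Finset.mem_union_right s) fun _ _ => Subset.rfl)⟩)
    exact ⟨t, iUnion₂_subset fun K hK => ht hK⟩
  · intro x hx y hxy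
    obtain ⟨K, hK, hxK⟩ := mem_iUnion₂.1 hx
    exact mem_iUnion₂.2 ⟨K, hK, K.2.2.2 x hxK y hxy⟩

theorem WellFiltered.kSp (hX : WellFiltered X) : WellFiltered (KSp X) := by
  intro 𝔽 h𝔽 𝒰 h𝒰 hsub
  by_contra! hcon
  obtain ⟨𝒜, h𝒜𝒰, ⟨h𝒜c, h𝒜m⟩, hmin⟩ := exists_minimal_isClosed_inter_nonempty
    (fun 𝒢 h𝒢 => (h𝔽.2.1 𝒢 h𝒢).2.1) h𝒰.isClosed_compl fun 𝒢 h𝒢 => by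
      obtain ⟨K, hK, hK𝒰⟩ := not_subset.1 (hcon 𝒢 h𝒢)
      exact ⟨K, hK𝒰, hK⟩
  let un : Set (KSp X) → Set X := fun 𝒢 => ⋃ K ∈ 𝒜 ∩ 𝒢, K.1
  have hun : FilteredFamily (un '' 𝔽) := by
    refine ⟨h𝔽.1.image _, ?_, ?_⟩
    · rintro _ ⟨𝒢, h𝒢, rfl⟩
      exact isCompactSaturated_biUnion (h𝒜m 𝒢 h𝒢) ((h𝔽.2.1 𝒢 h𝒢).2.1.inter_left h𝒜c)
    · rintro _ ⟨𝒢, h𝒢, rfl⟩ _ ⟨ℋ, hℋ, rfl⟩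
      obtain ⟨ℳ, hℳ, h₁, h₂⟩ := h𝔽.2.2 𝒢 h𝒢 ℋ hℋ
      exact ⟨_, ⟨ℳ, hℳ, rfl⟩, biUnion_subset_biUnion_left (inter_subset_inter_right _ h₁),
        biUnion_subset_biUnion_left (inter_subset_inter_right _ h₂)⟩
  let K : KSp X := ⟨_, isCompactSaturated_sInter hX hun⟩
  have hK𝒜 : K ∈ 𝒜 := by
    by_contra hK
    obtain ⟨U, hU, hKU, hUsub⟩ := exists_box_subset h𝒜c.isOpen_compl hK
    obtain ⟨_, ⟨𝒢, h𝒢, rfl⟩, h𝒢U⟩ := hX _ hun U hU hKU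
    obtain ⟨L, hL⟩ := h𝒜m 𝒢 h𝒢
    exact hUsub L ((subset_biUnion_of_mem (u := fun K : KSp X => K.1) hL).trans h𝒢U) hL.1
  have hKle : ∀ L ∈ 𝒜, K.1 ⊆ L.1 := by
    intro L hL x hx
    refine (hmin (y := 𝒜 ∩ {M : KSp X | x ∈ M.1})
      ⟨h𝒜c.inter (isClosed_setOf_mem x), fun 𝒢 h𝒢 => ?_⟩ inter_subset_left hL).2
    obtain ⟨M, hM, hxM⟩ := mem_iUnion₂.1 (hx _ ⟨𝒢, h𝒢, rfl⟩)
    exact ⟨M, ⟨hM.1, hxM⟩, hM.2⟩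
  refine h𝒜𝒰 hK𝒜 (hsub fun 𝒢 h𝒢 => ?_)
  obtain ⟨L, hL𝒜, hL𝒢⟩ := h𝒜m 𝒢 h𝒢
  exact (h𝔽.2.1 𝒢 h𝒢).2.2 L hL𝒢 K (mem_closure_singleton_iff_subset.2 (hKle L hL𝒜))

end

/-- For a T₀ space `X` the following are equivalent: (1) `X` is
well-filtered; (2) the Smyth power space `P_S(X)` is a d-space; (3) `P_S(X)` is
well-filtered. -/
theorem stmt9 (X : Type u) [TopologicalSpace X] [T0Space X] :
    (WellFiltered X ↔ DSpace (KSp X)) ∧ (WellFiltered X ↔ WellFiltered (KSp X)) :=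
  ⟨⟨WellFiltered.dSpace_kSp, wellFiltered_of_dSpace_kSp⟩,
    ⟨WellFiltered.kSp, wellFiltered_of_wellFiltered_kSp⟩⟩
end

section
/- Every core compact well-filtered T₀ space is sober. -/
universe u v

open Set TopologicalSpace

/-- `V` is way below `U`: every open cover of `U` has a finite subfamily covering `V`. -/
def OpenWayBelow {X : Type u} [TopologicalSpace X] (V U : Set X) : Prop :=
  ∀ 𝒞 : Set (Set X), (∀ W ∈ 𝒞, IsOpen W) → U ⊆ ⋃₀ 𝒞 →
    ∃ 𝒟 : Set (Set X), 𝒟 ⊆ 𝒞 ∧ 𝒟.Finite ∧ V ⊆ ⋃₀ 𝒟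

namespace OpenWayBelow

variable {X : Type u} [TopologicalSpace X]

theorem empty (U : Set X) : OpenWayBelow ∅ U := fun _ _ _ =>
  ⟨∅, empty_subset _, finite_empty, empty_subset _⟩

theorem mono {V V' U U' : Set X} (h : OpenWayBelow V U) (hV : V' ⊆ V) (hU : U ⊆ U') :
    OpenWayBelow V' U' := fun 𝒞 h𝒞 hc =>
  let ⟨𝒟, h₁, h₂, h₃⟩ := h 𝒞 h𝒞 (hU.trans hc)
  ⟨𝒟, h₁, h₂, hV.trans h₃⟩

theorem union {V₁ V₂ U : Set X} (h₁ : OpenWayBelow V₁ U) (h₂ : OpenWayBelow V₂ U) :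
    OpenWayBelow (V₁ ∪ V₂) U := fun 𝒞 h𝒞 hc => by
  obtain ⟨𝒟₁, hs₁, hf₁, hV₁⟩ := h₁ 𝒞 h𝒞 hc
  obtain ⟨𝒟₂, hs₂, hf₂, hV₂⟩ := h₂ 𝒞 h𝒞 hc
  refine ⟨𝒟₁ ∪ 𝒟₂, union_subset hs₁ hs₂, hf₁.union hf₂, ?_⟩
  rw [sUnion_union]
  exact union_subset_union hV₁ hV₂

/-- If `V` is way below `U`, then `V` lies in a member of any family of open sets which covers
`U`, contains `∅` and is closed under binary unions. -/
theorem exists_subset_of_union_mem {V U : Set X} (h : OpenWayBelow V U) {𝒞 : Set (Set X)}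
    (hopen : ∀ W ∈ 𝒞, IsOpen W) (hcover : U ⊆ ⋃₀ 𝒞) (hempty : ∅ ∈ 𝒞)
    (hunion : ∀ W₁ ∈ 𝒞, ∀ W₂ ∈ 𝒞, W₁ ∪ W₂ ∈ 𝒞) : ∃ W ∈ 𝒞, V ⊆ W := by
  obtain ⟨𝒟, hs, hf, hV⟩ := h 𝒞 hopen hcover
  refine ⟨⋃₀ 𝒟, ?_, hV⟩
  clear hV
  induction 𝒟, hf using Set.Finite.induction_on with
  | empty => simpa using hempty
  | insert _ _ ih =>
    rw [sUnion_insert]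
    exact hunion _ (hs (mem_insert _ _)) _ (ih ((subset_insert _ _).trans hs))

theorem interpolate (hX : CoreCompact X) {V U : Set X} (hU : IsOpen U)
    (h : OpenWayBelow V U) : ∃ W, IsOpen W ∧ OpenWayBelow V W ∧ OpenWayBelow W U := by
  obtain ⟨W, ⟨-, W', hW', hWW', hW'U⟩, hVW⟩ := h.exists_subset_of_union_mem
    (𝒞 := {W | IsOpen W ∧ ∃ W', IsOpen W' ∧ OpenWayBelow W W' ∧ OpenWayBelow W' U})
    (fun W hW => hW.1)
    (fun x hx => by
      obtain ⟨W', hW', hxW', hW'U⟩ := hX x U hU hx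
      obtain ⟨W, hW, hxW, hWW'⟩ := hX x W' hW' hxW'
      exact ⟨W, ⟨hW, W', hW', hWW', hW'U⟩, hxW⟩)
    ⟨isOpen_empty, ∅, isOpen_empty, .empty _, .empty _⟩
    (by
      rintro W₁ ⟨h₁, W₁', h₁', hW₁, hU₁⟩ W₂ ⟨h₂, W₂', h₂', hW₂, hU₂⟩
      exact ⟨h₁.union h₂, W₁' ∪ W₂', h₁'.union h₂',
        (hW₁.mono subset_rfl subset_union_left).union (hW₂.mono subset_rfl subset_union_right),
        hU₁.union hU₂⟩)
  exact ⟨W', hW', hWW'.mono hVW subset_rfl, hW'U⟩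

/-- In a core compact space, a way-below pair `V`, `U` is interpolated by a sequence starting
at `U` in which each member is way below the previous one. -/
theorem exists_seq (hX : CoreCompact X) {V U : Set X} (hU : IsOpen U) (h : OpenWayBelow V U) :
    ∃ O : ℕ → Set X, O 0 = U ∧ (∀ n, IsOpen (O n)) ∧ (∀ n, OpenWayBelow V (O n)) ∧
      ∀ n, OpenWayBelow (O (n + 1)) (O n) := by
  choose f hf using fun W : {W : Set X // IsOpen W ∧ OpenWayBelow V W} =>
    interpolate hX W.2.1 W.2.2
  let g : ℕ → {W : Set X // IsOpen W ∧ OpenWayBelow V W} := fun n =>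
    n.rec ⟨U, hU, h⟩ fun _ W => ⟨f W, (hf W).1, (hf W).2.1⟩
  exact ⟨fun n => (g n).1, rfl, fun n => (g n).2.1, fun n => (g n).2.2, fun n => (hf (g n)).2.2⟩

theorem subset {V U : Set X} (h : OpenWayBelow V U) (hU : IsOpen U) : V ⊆ U := by
  obtain ⟨𝒟, hs, -, hV⟩ := h {U} (by simpa using hU) (by simp)
  exact hV.trans (sUnion_subset fun W hW => (hs hW).subset)

/-- A form of Rudin's lemma: a closed set meeting every term of a way-below-decreasing
sequence contains a minimal such closed set. -/
theorem exists_minimal_closed {O : ℕ → Set X}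
    (hlt : ∀ n, OpenWayBelow (O (n + 1)) (O n)) {F : Set X} (hF : IsClosed F)
    (hFO : ∀ n, (F ∩ O n).Nonempty) :
    ∃ C ⊆ F, IsClosed C ∧ (∀ n, (C ∩ O n).Nonempty) ∧
      ∀ B ⊆ C, IsClosed B → (∀ n, (B ∩ O n).Nonempty) → B = C := by
  obtain ⟨C, hCF, hC⟩ := zorn_superset_nonempty
    {C : Set X | IsClosed C ∧ ∀ n, (C ∩ O n).Nonempty} (by
      intro c hc hchain hne
      refine ⟨⋂₀ c, ⟨isClosed_sInter fun s hs => (hc hs).1, fun n => ?_⟩,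
        fun s hs => sInter_subset_of_mem hs⟩
      by_contra hemp
      rw [not_nonempty_iff_eq_empty] at hemp
      obtain ⟨W, hW, hsub⟩ := (hlt n).exists_subset_of_union_mem
        (𝒞 := insert ∅ (compl '' c)) (by
          rintro W (rfl | ⟨s, hs, rfl⟩)
          · exact isOpen_empty
          · exact (hc hs).1.isOpen_compl)
        (by
          intro x hx
          have hxc : x ∉ ⋂₀ c := fun h => by
            have : x ∈ ⋂₀ c ∩ O n := ⟨h, hx⟩
            simp [hemp] at this
          rw [mem_sInter] at hxc
          push Not at hxc
          obtain ⟨s, hs, hxs⟩ := hxc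
          exact ⟨sᶜ, .inr ⟨s, hs, rfl⟩, hxs⟩)
        (mem_insert _ _)
        (by
          rintro W₁ (rfl | ⟨s, hs, rfl⟩) W₂ (rfl | ⟨t, ht, rfl⟩)
          · simp
          · rw [empty_union]; exact .inr ⟨t, ht, rfl⟩
          · rw [union_empty]; exact .inr ⟨s, hs, rfl⟩
          · rw [← compl_inter]
            rcases hchain.total hs ht with h | h
            · rw [inter_eq_left.2 h]; exact .inr ⟨s, hs, rfl⟩
            · rw [inter_eq_right.2 h]; exact .inr ⟨t, ht, rfl⟩)
      rcases hW with rfl | ⟨s, hs, rfl⟩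
      · obtain ⟨s, hs⟩ := hne
        obtain ⟨x, -, hx⟩ := (hc hs).2 (n + 1)
        exact hsub hx
      · obtain ⟨x, hxs, hx⟩ := (hc hs).2 (n + 1)
        exact hsub hx hxs)
    F ⟨hF, hFO⟩
  exact ⟨C, hCF, hC.prop.1, hC.prop.2, fun B hBC hB hBO =>
    hBC.antisymm (hC.le_of_le ⟨hB, hBO⟩ hBC)⟩

end OpenWayBelow

section

variable {X : Type u} [TopologicalSpace X]

theorem IsOpen.mem_of_mem_closure_singleton {U : Set X} (hU : IsOpen U) {x y : X} (hx : x ∈ U)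
    (hxy : x ∈ closure ({y} : Set X)) : y ∈ U := by
  obtain ⟨z, hz, rfl⟩ := mem_closure_iff.1 hxy U hU hx
  exact hz

theorem subset_upSet (A : Set X) : A ⊆ upSet X A := fun a ha => ⟨a, ha, subset_closure rfl⟩

theorem IsOpen.upSet_subset {U A : Set X} (hU : IsOpen U) (h : A ⊆ U) : upSet X A ⊆ U := by
  rintro y ⟨a, ha, hay⟩
  exact hU.mem_of_mem_closure_singleton (h ha) hay

theorem IsCompact.isCompactSaturated_upSet {A : Set X} (hA : IsCompact A) (hne : A.Nonempty) :
    IsCompactSaturated (upSet X A) := by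
  refine ⟨hne.mono (subset_upSet A), isCompact_of_finite_subcover fun U hU hc => ?_, ?_⟩
  · obtain ⟨t, ht⟩ := hA.elim_finite_subcover U hU ((subset_upSet A).trans hc)
    exact ⟨t, (isOpen_biUnion fun i _ => hU i).upSet_subset ht⟩
  · rintro x ⟨a, ha, hax⟩ y hxy
    exact ⟨a, ha, closure_minimal (singleton_subset_iff.2 hxy) isClosed_closure hax⟩

/-- If each open set meeting the range of a sequence contains all later terms, then every
tail of the sequence is compact. -/
theorem isCompact_image_Ici_of_eventually_mem {x : ℕ → X}
    (hx : ∀ U, IsOpen U → ∀ k, x k ∈ U → ∃ m, ∀ j ≥ m, x j ∈ U) (n : ℕ) :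
    IsCompact (x '' Ici n) := by
  refine isCompact_of_finite_subcover fun U hU hc => ?_
  classical
  choose i hi using fun k : Ici n => mem_iUnion.1 (hc (mem_image_of_mem x k.2))
  obtain ⟨m, hm⟩ := hx _ (hU (i ⟨n, self_mem_Ici⟩)) n (hi ⟨n, self_mem_Ici⟩)
  have hfin : (range fun k : Ici n => if k.1 < m then i k else i ⟨n, self_mem_Ici⟩).Finite := by
    refine (((finite_Iio m).preimage (f := Subtype.val)
      Subtype.val_injective.injOn).image i |>.insert (i ⟨n, self_mem_Ici⟩)).subset ?_
    rintro _ ⟨k, rfl⟩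
    by_cases hk : k.1 < m
    · simp only [hk, if_true]
      exact .inr ⟨k, hk, rfl⟩
    · simp only [hk, if_false]
      exact .inl rfl
  refine ⟨hfin.toFinset, ?_⟩
  rintro _ ⟨k, hk, rfl⟩
  refine mem_biUnion (hfin.mem_toFinset.2 ⟨⟨k, hk⟩, rfl⟩) ?_
  by_cases h : k < m
  · simpa only [h, if_true] using hi ⟨k, hk⟩
  · simpa only [h, if_false] using hm k (not_lt.1 h)

/-- In a well-filtered space, an open set containing the intersection of a
way-below-decreasing sequence of open sets contains one of its terms. -/
theorem WellFiltered.exists_subset_of_iInter_subset (hX : WellFiltered X) {O : ℕ → Set X}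
    (hO : ∀ n, IsOpen (O n)) (hlt : ∀ n, OpenWayBelow (O (n + 1)) (O n)) {W : Set X}
    (hW : IsOpen W) (h : ⋂ n, O n ⊆ W) : ∃ n, O n ⊆ W := by
  by_contra! hne
  obtain ⟨C, hCW, hC, hCO, hmin⟩ := OpenWayBelow.exists_minimal_closed hlt hW.isClosed_compl
    fun n => let ⟨x, hx, hxW⟩ := not_subset.1 (hne n); ⟨x, hxW, hx⟩
  choose x hxC hxO using hCO
  have hanti : Antitone O := antitone_nat_of_succ_le fun n => (hlt n).subset (hO n)
  have hx : ∀ U, IsOpen U → ∀ k, x k ∈ U → ∃ m, ∀ j ≥ m, x j ∈ U := by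
    intro U hU k hk
    by_contra! hcon
    have := hmin (C \ U) sdiff_subset (hC.sdiff hU) fun n => by
      obtain ⟨j, hj, hjU⟩ := hcon n
      exact ⟨x j, ⟨hxC j, hjU⟩, hanti hj (hxO j)⟩
    exact (this.symm ▸ hxC k : x k ∈ C \ U).2 hk
  obtain ⟨_, ⟨n, rfl⟩, hn⟩ := hX (range fun n => upSet X (x '' Ici n))
    ⟨range_nonempty _, by
      rintro _ ⟨n, rfl⟩
      exact (isCompact_image_Ici_of_eventually_mem hx n).isCompactSaturated_upSet
        (nonempty_Ici.image x), by
      rintro _ ⟨n, rfl⟩ _ ⟨m, rfl⟩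
      refine ⟨_, ⟨max n m, rfl⟩, ?_, ?_⟩ <;> rintro y ⟨a, ⟨k, hk, rfl⟩, hay⟩
      · exact ⟨x k, ⟨k, (le_max_left n m).trans hk, rfl⟩, hay⟩
      · exact ⟨x k, ⟨k, (le_max_right n m).trans hk, rfl⟩, hay⟩⟩
    W hW fun y hy => h <| mem_iInter.2 fun n => by
      refine (hO n).upSet_subset ?_ (hy _ ⟨n, rfl⟩)
      rintro _ ⟨k, hk, rfl⟩
      exact hanti hk (hxO k)
  exact hCW (hxC n) (hn (subset_upSet _ ⟨n, self_mem_Ici, rfl⟩))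

theorem WellFiltered.locallyCompactSat (hX : WellFiltered X) (hcore : CoreCompact X) :
    LocallyCompactSat X := by
  intro x U hU hxU
  obtain ⟨V, hV, hxV, hVU⟩ := hcore x U hU hxU
  obtain ⟨O, rfl, hO, hVO, hlt⟩ := OpenWayBelow.exists_seq hcore hU hVU
  have hVK : V ⊆ ⋂ n, O n := subset_iInter fun n => (hVO n).subset (hO n)
  refine ⟨⋂ n, O n, ⟨⟨x, hVK hxV⟩, isCompact_of_finite_subcover fun {ι} W hW hc => ?_, ?_⟩,
    interior_maximal hVK hV hxV, iInter_subset O 0⟩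
  · obtain ⟨n, hn⟩ := hX.exists_subset_of_iInter_subset hO hlt (isOpen_iUnion hW) hc
    obtain ⟨𝒟, hs, hf, hsub⟩ := hlt n (range W) (by rintro _ ⟨i, rfl⟩; exact hW i) hn
    have : Nonempty ι := ⟨(mem_iUnion.1 (hc (hVK hxV))).choose⟩
    choose! i hi using hs
    classical
    refine ⟨hf.toFinset.image i, fun z hz => ?_⟩
    obtain ⟨S, hS, hzS⟩ := hsub (mem_iInter.1 hz (n + 1))
    exact mem_biUnion (Finset.mem_image_of_mem i (hf.mem_toFinset.2 hS)) ((hi hS).symm ▸ hzS)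
  · intro y hy z hyz
    exact mem_iInter.2 fun n => (hO n).mem_of_mem_closure_singleton (mem_iInter.1 hy n) hyz

theorem WellFiltered.soberSpace [T0Space X] (hX : WellFiltered X) (hloc : LocallyCompactSat X) :
    SoberSpace X := by
  intro A hirr hA
  obtain ⟨x, hxK, hxA⟩ : (⋂₀ {K : Set X | IsCompactSaturated K ∧ (A ∩ interior K).Nonempty} ∩
      A).Nonempty := by
    by_contra hemp
    obtain ⟨K, ⟨-, y, hyA, hyK⟩, hKA⟩ := hX
      {K : Set X | IsCompactSaturated K ∧ (A ∩ interior K).Nonempty}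
      ⟨by
        obtain ⟨a, ha⟩ := hirr.nonempty
        obtain ⟨K, hK, haK, -⟩ := hloc a univ isOpen_univ trivial
        exact ⟨K, hK, a, ha, haK⟩, fun K hK => hK.1, by
        rintro K₁ ⟨-, h₁⟩ K₂ ⟨-, h₂⟩
        obtain ⟨a, ha, haK⟩ := hirr.isPreirreducible _ _ isOpen_interior isOpen_interior h₁ h₂
        obtain ⟨K, hK, haK', hsub⟩ := hloc a _ (isOpen_interior.inter isOpen_interior) haK
        exact ⟨K, ⟨hK, a, ha, haK'⟩, fun z hz => interior_subset (hsub hz).1,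
          fun z hz => interior_subset (hsub hz).2⟩⟩
      Aᶜ hA.isOpen_compl fun z hz hzA => hemp ⟨z, hz, hzA⟩
    exact hKA (interior_subset hyK) hyA
  have hclosure : closure {x} = A := by
    refine (closure_minimal (singleton_subset_iff.2 hxA) hA).antisymm fun a ha =>
      mem_closure_iff.2 fun U hU haU => ?_
    obtain ⟨K, hK, haK, hKU⟩ := hloc a U hU haU
    exact ⟨x, hKU (hxK K ⟨hK, a, ha, haK⟩), rfl⟩
  exact ⟨x, hclosure, fun y hy => (inseparable_iff_closure_eq.2 (hy.trans hclosure.symm)).eq⟩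

end

/-- Every core compact well-filtered T₀ space is sober. -/
theorem stmt16 (X : Type u) [TopologicalSpace X] [T0Space X]
    (h1 : CoreCompact X) (h2 : WellFiltered X) : SoberSpace X := by
  exact h2.soberSpace (h2.locallyCompactSat h1)
end
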